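/- For every triangular number k ≥ 1, the number 2^{2k-2} + 2^{2k-3} + ⋯ + 2^{k-1} (that is, the sum of 2^i for i ranging from k−1 to 2k−2) is very triangular. -/

import Mathlib

/-- The n-th triangular number. -/
def triangular (n : ℕ) : ℕ := n * (n + 1) / 2

/-- A natural number is triangular if it is `triangular n` for some `n`. -/
def IsTriangular (m : ℕ) : Prop := ∃ n : ℕ, triangular n = m

/-- The number of 1s in the binary representation of `m` (binary digit sum). -/
def binOnes (m : ℕ) : ℕ := (Nat.digits 2 m).sum

/-- A number is very triangular if it is triangular and its binary digit sum is triangular. -/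
def IsVeryTriangular (m : ℕ) : Prop := IsTriangular m ∧ IsTriangular (binOnes m)

theorem binOnes_two_mul (m : ℕ) : binOnes (2 * m) = binOnes m := by
  rcases Nat.eq_zero_or_pos m with rfl | hm
  · rfl
  · simp [binOnes, Nat.digits_base_mul one_lt_two hm]

theorem binOnes_two_mul_add_one (m : ℕ) : binOnes (2 * m + 1) = binOnes m + 1 := by
  have h := Nat.digits_add_two_add_one 0 (2 * m)
  have hdiv : (2 * m + 1) / 2 = m := by omega
  have hmod : (2 * m + 1) % 2 = 1 := by omega
  simp only [zero_add, hdiv, hmod] at h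
  rw [binOnes, h, List.sum_cons, add_comm, binOnes]

theorem binOnes_two_pow_mul (j m : ℕ) : binOnes (2 ^ j * m) = binOnes m := by
  induction j with
  | zero => simp
  | succ j ih => rw [pow_succ', mul_assoc, binOnes_two_mul, ih]

theorem binOnes_two_pow_sub_one (n : ℕ) : binOnes (2 ^ n - 1) = n := by
  induction n with
  | zero => simp [binOnes]
  | succ n ih =>
    have hpos : 0 < 2 ^ n := by positivity
    have h : 2 ^ (n + 1) - 1 = 2 * (2 ^ n - 1) + 1 := by rw [pow_succ]; omega
    rw [h, binOnes_two_mul_add_one, ih]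

theorem sum_Icc_two_pow (j : ℕ) :
    ∑ i ∈ Finset.Icc j (2 * j), 2 ^ i = 2 ^ j * (2 ^ (j + 1) - 1) := by
  have hIcc : Finset.Icc j (2 * j) = Finset.Ico j (2 * j + 1) := by
    ext; simp only [Finset.mem_Icc, Finset.mem_Ico]; omega
  have hlen : 2 * j + 1 - j = j + 1 := by omega
  rw [hIcc, Finset.sum_Ico_eq_sum_range, hlen]
  simp only [pow_add _ j]
  rw [← Finset.mul_sum, Nat.geomSum_eq le_rfl]
  simp [pow_succ]

theorem triangular_two_pow_sub_one (j : ℕ) :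
    triangular (2 ^ (j + 1) - 1) = 2 ^ j * (2 ^ (j + 1) - 1) := by
  have hpos : 1 ≤ 2 ^ (j + 1) := Nat.one_le_two_pow
  rw [triangular, Nat.sub_add_cancel hpos]
  apply Nat.div_eq_of_eq_mul_left two_pos
  conv_lhs => rw [mul_comm]
  rw [mul_right_comm, ← pow_succ]

theorem stmt8 (k : ℕ) (hk : IsTriangular k) (hk1 : 1 ≤ k) :
    IsVeryTriangular (∑ i ∈ Finset.Icc (k - 1) (2 * k - 2), 2 ^ i) := by
  obtain ⟨j, rfl⟩ := Nat.exists_eq_add_of_le' hk1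
  have htop : 2 * (j + 1) - 2 = 2 * j := by omega
  rw [Nat.add_sub_cancel, htop, sum_Icc_two_pow]
  refine ⟨⟨_, triangular_two_pow_sub_one j⟩, ?_⟩
  rwa [binOnes_two_pow_mul, binOnes_two_pow_sub_one]
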